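/- Non-degeneracy of extremal depth (Proposition 3): The range of extremal depth is (0,1], i.e., {α ∈ [0,1] : ED(f,P) = α for some f ∈ C(I,ℝ)} = (0,1]. In particular, every f ∈ C(I,ℝ) satisfies ED(f,P) > 0, every value in (0,1] is attained, and no function has extremal depth 0. -/

import Mathlib

open MeasureTheory Set Filter
open scoped NNReal ENNReal symmDiff

noncomputable section

/-- The space `C(I, ℝ)` of continuous real-valued functions on `I = [0,1]`,
equipped with the sup metric. -/
abbrev FSp := C(unitInterval, ℝ)

/-- Borel σ-algebra on `C(I, ℝ)`. -/
instance : MeasurableSpace FSp := borel FSp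
instance : BorelSpace FSp := ⟨rfl⟩

/-- Pointwise depth `D_g(t) = 1 - |P{x : x(t) > g(t)} - P{x : x(t) < g(t)}|`. -/
def pdepth (P : Measure FSp) (g : unitInterval → ℝ) (t : unitInterval) : ℝ :=
  1 - |(P {x : FSp | g t < x t}).toReal - (P {x : FSp | x t < g t}).toReal|

/-- Depth CDF (d-CDF) `Φ_g(r) = Leb{t ∈ I : D_g(t) ≤ r}`. -/
def dcdf (P : Measure FSp) (g : unitInterval → ℝ) (r : ℝ) : ℝ :=
  (volume {t : unitInterval | pdepth P g t ≤ r}).toReal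

/-- The set `R(g,h) = {r ∈ [0,1] : Φ_g(r) ≠ Φ_h(r)}`. -/
def Rset (P : Measure FSp) (g h : unitInterval → ℝ) : Set ℝ :=
  {r ∈ Icc (0:ℝ) 1 | dcdf P g r ≠ dcdf P h r}

/-- `g ≺ h`: `g` is more extreme than `h`, i.e. `R(g,h)` is nonempty and, with
`r* = inf R(g,h)`, there is `δ > 0` with `Φ_g(r) > Φ_h(r)` for all
`r ∈ (r*, r*+δ) ∩ [0,1]`.  `g ⪰ h` is `¬ prec P g h`. -/
def prec (P : Measure FSp) (g h : unitInterval → ℝ) : Prop :=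
  (Rset P g h).Nonempty ∧
  ∃ δ > 0, ∀ r ∈ Ioo (sInf (Rset P g h)) (sInf (Rset P g h) + δ) ∩ Icc (0:ℝ) 1,
    dcdf P h r < dcdf P g r

/-- Extremal depth `ED(g,P) = P*{x ∈ C(I,ℝ) : g ⪰ x}` (a measure applied to an
arbitrary set is the induced outer measure). -/
def ed (P : Measure FSp) (g : unitInterval → ℝ) : ℝ :=
  (P {x : FSp | ¬ prec P g ⇑x}).toReal

/-- Minimal depth level `d_f = inf{r ∈ [0,1] : Φ_f(r) > 0}`. -/
def dmin (P : Measure FSp) (f : unitInterval → ℝ) : ℝ :=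
  sInf {r ∈ Icc (0:ℝ) 1 | 0 < dcdf P f r}

/-- Marginal CDF `F_t(y) = P{x : x(t) ≤ y}`. -/
def margF (P : Measure FSp) (t : unitInterval) (y : ℝ) : ℝ :=
  (P {x : FSp | x t ≤ y}).toReal

/-- Pointwise quantile function `q_a(t) = inf{y : F_t(y) ≥ a}`. -/
def quant (P : Measure FSp) (a : ℝ) (t : unitInterval) : ℝ :=
  sInf {y : ℝ | a ≤ margF P t y}

/-- Lower envelope `f_L(t) = inf{f(t) : f ∈ C(I,ℝ), ED(f,P) > α}`. -/
def envL (P : Measure FSp) (α : ℝ) (t : unitInterval) : ℝ :=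
  sInf ((fun f : FSp => f t) '' {f : FSp | α < ed P ⇑f})

/-- Upper envelope `f_U(t) = sup{f(t) : f ∈ C(I,ℝ), ED(f,P) > α}`. -/
def envU (P : Measure FSp) (α : ℝ) (t : unitInterval) : ℝ :=
  sSup ((fun f : FSp => f t) '' {f : FSp | α < ed P ⇑f})

/-- The `(1-α)` extremal-depth central region `C_{1-α}`. -/
def centralRegion (P : Measure FSp) (α : ℝ) : Set FSp :=
  {x : FSp | ∀ t, envL P α t ≤ x t ∧ x t ≤ envU P α t}

/-- Boundary `∂C_{1-α}` of the central region. -/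
def centralBoundary (P : Measure FSp) (α : ℝ) : Set FSp :=
  {x ∈ centralRegion P α | ∃ t, x t = envL P α t ∨ x t = envU P α t}


lemma aux_vol_pos (U : Set unitInterval) (hU : IsOpen U) (hne : U.Nonempty) :
    0 < (volume : Measure unitInterval) U := by
  obtain ⟨V, hV, rfl⟩ := isOpen_induced_iff.1 hU
  obtain ⟨t, ht⟩ := hne
  have hcl : (t : ℝ) ∈ closure (Ioo (0:ℝ) 1) := by
    rw [closure_Ioo zero_ne_one]; exact t.2
  have hne2 : (V ∩ Ioo (0:ℝ) 1).Nonempty := mem_closure_iff.1 hcl V hV ht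
  have hpos := (hV.inter isOpen_Ioo).measure_pos (volume : Measure ℝ) hne2
  rw [Measure.Subtype.volume_def, comap_subtype_coe_apply measurableSet_Icc]
  refine hpos.trans_le (measure_mono ?_)
  rintro x ⟨hx1, hx2⟩
  exact ⟨⟨x, Ioo_subset_Icc_self hx2⟩, hx1, rfl⟩

lemma aux_dcdf_mono (P : Measure FSp) (g : unitInterval → ℝ) : Monotone (dcdf P g) := by
  intro a b hab
  unfold dcdf
  apply ENNReal.toReal_mono (measure_ne_top _ _)
  apply measure_mono
  intro t ht
  exact le_trans ht hab

lemma aux_dcdf_nonneg (P : Measure FSp) (g : unitInterval → ℝ) (r : ℝ) : 0 ≤ dcdf P g r :=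
  ENNReal.toReal_nonneg

lemma aux_key (P : Measure FSp) (g x : unitInterval → ℝ) (r r' : ℝ) (hr : 0 ≤ r) (hrr : r < r')
    (hr1 : r' ≤ 1) (hg : 0 < dcdf P g r) (hx : dcdf P x r' = 0) :
    0 ≤ sInf (Rset P g x) ∧ sInf (Rset P g x) < r' ∧ (Rset P g x).Nonempty ∧
    ∀ s ∈ Ioo (sInf (Rset P g x)) r', dcdf P x s < dcdf P g s := by
  have hz : ∀ s ≤ r', dcdf P x s = 0 := fun s hs =>
    le_antisymm (hx ▸ aux_dcdf_mono P x hs) (aux_dcdf_nonneg P x s)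
  have hmem : r ∈ Rset P g x :=
    ⟨⟨hr, by linarith⟩, by rw [hz r hrr.le]; exact hg.ne'⟩
  have hne : (Rset P g x).Nonempty := ⟨r, hmem⟩
  have hbd : BddBelow (Rset P g x) := ⟨0, fun s hs => hs.1.1⟩
  refine ⟨le_csInf hne fun s hs => hs.1.1, (csInf_le hbd hmem).trans_lt hrr, hne, ?_⟩
  rintro s ⟨hs1, hs2⟩
  obtain ⟨q, hq, hqs⟩ := exists_lt_of_csInf_lt hne hs1
  rw [hz s hs2.le]
  have h2 := hq.2
  rw [hz q (by linarith)] at h2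
  exact (lt_of_le_of_ne (aux_dcdf_nonneg P g q) h2.symm).trans_le (aux_dcdf_mono P g hqs.le)

lemma aux_prec (P : Measure FSp) (g x : unitInterval → ℝ) (r r' : ℝ) (hr : 0 ≤ r) (hrr : r < r')
    (hr1 : r' ≤ 1) (hg : 0 < dcdf P g r) (hx : dcdf P x r' = 0) :
    prec P g x ∧ ¬ prec P x g := by
  obtain ⟨h0, h1, h2, h3⟩ := aux_key P g x r r' hr hrr hr1 hg hx
  refine ⟨⟨h2, r' - sInf (Rset P g x), by linarith, ?_⟩, ?_⟩
  · rintro s ⟨⟨hs1, hs2⟩, -⟩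
    exact h3 s ⟨hs1, by linarith⟩
  · rintro ⟨-, δ, hδ, h4⟩
    have hs : Rset P x g = Rset P g x := by
      ext s; simp only [Rset, mem_ofPred_eq, ne_comm]
    rw [hs] at h4
    obtain ⟨s, hs1, hs2⟩ := exists_between (a₁ := sInf (Rset P g x))
      (a₂ := min (sInf (Rset P g x) + δ) r') (lt_min (by linarith) h1)
    obtain ⟨hs3, hs4⟩ := lt_min_iff.1 hs2
    have := h4 s ⟨⟨hs1, hs3⟩, ⟨by linarith, by linarith⟩⟩
    have := h3 s ⟨hs1, hs4⟩
    linarith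

/-- Signed tail difference of the standard Gaussian. -/
def auxG (s : ℝ) : ℝ :=
  ((ProbabilityTheory.gaussianReal 0 1) (Ioi s)).toReal -
    ((ProbabilityTheory.gaussianReal 0 1) (Iio s)).toReal

lemma auxG_neg (s : ℝ) : auxG (-s) = - auxG s := by
  have hm : (ProbabilityTheory.gaussianReal 0 1).map (fun x => -x)
      = ProbabilityTheory.gaussianReal 0 1 := by
    rw [ProbabilityTheory.gaussianReal_map_neg]; simp
  have h1 : (ProbabilityTheory.gaussianReal 0 1) (Ioi (-s))
      = (ProbabilityTheory.gaussianReal 0 1) (Iio s) := by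
    conv_lhs => rw [← hm]
    rw [Measure.map_apply (by fun_prop) measurableSet_Ioi]
    congr 1; ext x; simp
  have h2 : (ProbabilityTheory.gaussianReal 0 1) (Iio (-s))
      = (ProbabilityTheory.gaussianReal 0 1) (Ioi s) := by
    conv_lhs => rw [← hm]
    rw [Measure.map_apply (by fun_prop) measurableSet_Iio]
    congr 1; ext x; simp
  unfold auxG
  rw [h1, h2]; ring

lemma auxGauss_pos (U : Set ℝ) (hU : IsOpen U) (hne : U.Nonempty) :
    0 < (ProbabilityTheory.gaussianReal 0 1) U := by
  have := hU.measure_pos (volume : Measure ℝ) hne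
  rw [pos_iff_ne_zero]
  intro h0
  exact this.ne' ((ProbabilityTheory.gaussianReal_absolutelyContinuous' 0 (by simp)) h0)

lemma auxG_anti : StrictAnti auxG := by
  intro a b hab
  unfold auxG
  have h1 : ((ProbabilityTheory.gaussianReal 0 1) (Ioi b)).toReal ≤
      ((ProbabilityTheory.gaussianReal 0 1) (Ioi a)).toReal :=
    ENNReal.toReal_mono (measure_ne_top _ _) (measure_mono (Ioi_subset_Ioi hab.le))
  have h2 : ((ProbabilityTheory.gaussianReal 0 1) (Iio a)).toReal <
      ((ProbabilityTheory.gaussianReal 0 1) (Iio b)).toReal := by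
    apply (ENNReal.toReal_lt_toReal (measure_ne_top _ _) (measure_ne_top _ _)).2
    have h3 : (ProbabilityTheory.gaussianReal 0 1) (Iio a) +
        (ProbabilityTheory.gaussianReal 0 1) (Ioo a b) ≤
        (ProbabilityTheory.gaussianReal 0 1) (Iio b) := by
      rw [← measure_union _ measurableSet_Ioo]
      · apply measure_mono
        rintro x (hx | hx)
        · exact lt_trans hx hab
        · exact hx.2
      · rw [Set.disjoint_left]
        intro x hx hx2
        exact lt_asymm hx hx2.1
    refine lt_of_lt_of_le (ENNReal.lt_add_right (measure_ne_top _ _) ?_) h3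
    exact (auxGauss_pos _ isOpen_Ioo (nonempty_Ioo.2 hab)).ne'
  linarith

lemma auxG_abs (s : ℝ) : |auxG s| = - auxG |s| := by
  have h0 : auxG 0 = 0 := by have := auxG_neg 0; simp at this; linarith
  rcases le_total 0 s with hs | hs
  · rw [abs_of_nonneg hs, abs_of_nonpos (h0 ▸ auxG_anti.antitone hs)]
  · rw [abs_of_nonpos hs, auxG_neg, abs_of_nonneg (h0 ▸ auxG_anti.antitone hs), neg_neg]

/-- Depth as a function of the standardized modulus. -/
def auxψ (s : ℝ) : ℝ := 1 + auxG s

lemma auxψ_anti : StrictAnti auxψ := fun a b hab => by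
  unfold auxψ; have := auxG_anti hab; linarith

lemma auxψ_le {s : ℝ} (hs : 0 ≤ s) : auxψ s ≤ 1 := by
  have h0 : auxG 0 = 0 := by have := auxG_neg 0; simp at this; linarith
  have := auxG_anti.antitone hs
  unfold auxψ; linarith

lemma auxψ_nonneg (s : ℝ) : 0 ≤ auxψ s := by
  unfold auxψ auxG
  have h1 : ((ProbabilityTheory.gaussianReal 0 1) (Iio s)).toReal ≤ 1 :=
    ENNReal.toReal_le_of_le_ofReal zero_le_one (by simpa using prob_le_one)
  have h2 : 0 ≤ ((ProbabilityTheory.gaussianReal 0 1) (Ioi s)).toReal := ENNReal.toReal_nonneg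
  linarith

lemma auxGauss_scale (s : ℝ) (hs : 0 < s) (A : Set ℝ) (hA : MeasurableSet A) :
    (ProbabilityTheory.gaussianReal 0 ⟨s ^ 2, sq_nonneg _⟩) A =
      (ProbabilityTheory.gaussianReal 0 1) {x | s * x ∈ A} := by
  have := ProbabilityTheory.gaussianReal_map_const_mul (μ := 0) (v := 1) s
  rw [mul_zero, mul_one] at this
  have h2 : (ProbabilityTheory.gaussianReal 0 ⟨s ^ 2, sq_nonneg _⟩) =
      (ProbabilityTheory.gaussianReal 0 1).map (fun x => s * x) := this.symm
  rw [h2, Measure.map_apply (by fun_prop) hA]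
  rfl

/-- surjectivity of T -/
lemma auxT_surj (h : C(unitInterval × ℝ, ℝ))
    (hmono : ∀ t : unitInterval, StrictMono fun s => h (t, s))
    (hsurj : ∀ t : unitInterval, Function.Surjective fun s => h (t, s))
    (T : FSp → FSp) (hT : ∀ (x : FSp) (t : unitInterval), T x t = h (t, x t)) :
    Function.Surjective T := by
  intro g
  choose u hu using fun t => hsurj t (g t)
  simp only at hu
  have hc : Continuous u := by
    rw [continuous_iff_continuousAt]
    intro t0
    refine tendsto_order.2 ⟨fun a ha => ?_, fun b hb => ?_⟩
    · have h1 : h (t0, a) < g t0 := by rw [← hu]; exact hmono t0 ha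
      have h2 : ∀ᶠ t in nhds t0, h (t, a) < g t :=
        (by fun_prop : Continuous fun t => h (t, a)).continuousAt.eventually_lt
          g.continuous.continuousAt h1
      filter_upwards [h2] with t ht
      rw [← hu] at ht
      exact (hmono t).lt_iff_lt.1 ht
    · have h1 : g t0 < h (t0, b) := by rw [← hu]; exact hmono t0 hb
      have h2 : ∀ᶠ t in nhds t0, g t < h (t, b) :=
        g.continuous.continuousAt.eventually_lt
          (by fun_prop : Continuous fun t => h (t, b)).continuousAt h1
      filter_upwards [h2] with t ht
      rw [← hu] at ht
      exact (hmono t).lt_iff_lt.1 ht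
  refine ⟨⟨u, hc⟩, ?_⟩
  ext t
  rw [hT]
  exact hu t

lemma aux_cdf_cont (ν : Measure ℝ) [IsProbabilityMeasure ν] [NullSingletonClass ν] :
    Continuous (ProbabilityTheory.cdf ν) := by
  rw [continuous_iff_continuousAt]
  intro a
  have hm : Monotone (ProbabilityTheory.cdf ν) := ProbabilityTheory.monotone_cdf ν
  rw [hm.continuousAt_iff_leftLim_eq_rightLim, StieltjesFunction.rightLim_eq]
  have h1 := StieltjesFunction.measure_singleton (ProbabilityTheory.cdf ν) a
  rw [ProbabilityTheory.measure_cdf, measure_singleton] at h1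
  have h2 := ENNReal.ofReal_eq_zero.1 h1.symm
  have h3 := hm.leftLim_le (le_refl a)
  linarith

/-- **Proposition 3 (non-degeneracy of extremal depth).** For the transformed
Gaussian-type process, the range of extremal depth is exactly `(0,1]`. -/
theorem extremal_depth_nondegenerate
    (σ : C(unitInterval, ℝ)) (hσ : ∀ t, 0 < σ t)
    (P_Y : Measure FSp) [IsProbabilityMeasure P_Y]
    (hmargin : ∀ t : unitInterval,
      P_Y.map (fun x : FSp => x t) =
        ProbabilityTheory.gaussianReal 0 ⟨(σ t) ^ 2, sq_nonneg _⟩)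
    (hatom : ∀ c : ℝ, P_Y {x : FSp | (⨆ t, |x t| / σ t) = c} = 0)
    (h : C(unitInterval × ℝ, ℝ))
    (hmono : ∀ t : unitInterval, StrictMono fun s => h (t, s))
    (hsurj : ∀ t : unitInterval, Function.Surjective fun s => h (t, s))
    (T : FSp → FSp) (hT : ∀ (x : FSp) (t : unitInterval), T x t = h (t, x t))
    (hTcont : Continuous T)
    (P : Measure FSp) (hP : P = P_Y.map T) :
    {α : ℝ | α ∈ Icc (0:ℝ) 1 ∧ ∃ f : FSp, ed P ⇑f = α} = Ioc (0:ℝ) 1 := by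
  classical
  have hTsurj := auxT_surj h hmono hsurj T hT
  have hTinj : Function.Injective T := by
    intro x y hxy
    ext t
    have := DFunLike.congr_fun hxy t
    rw [hT, hT] at this
    exact (hmono t).injective this
  have hemb : MeasurableEmbedding T := hTcont.measurableEmbedding hTinj
  -- the sup functional
  let τ : FSp := ⟨fun t => (σ t)⁻¹, σ.continuous.inv₀ fun t => (hσ t).ne'⟩
  let M : FSp → ℝ := fun y => ‖y * τ‖
  have hMc : Continuous M := by fun_prop
  have hyt : ∀ (y : FSp) t, ‖(y * τ) t‖ = |y t| / σ t := by
    intro y t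
    change ‖y t * (σ t)⁻¹‖ = _
    rw [Real.norm_eq_abs, abs_mul, abs_of_pos (inv_pos.2 (hσ t)), div_eq_mul_inv]
  have hMsup : ∀ y, M y = ⨆ t, |y t| / σ t := by
    intro y
    change ‖y * τ‖ = _
    rw [ContinuousMap.norm_eq_iSup_norm]
    simp only [hyt]
  have hMle : ∀ (y : FSp) t, |y t| / σ t ≤ M y := fun y t => by
    rw [← hyt]; exact ContinuousMap.norm_coe_le_norm (y * τ) t
  have hMlt : ∀ (y : FSp) (c : ℝ), 0 ≤ c → c < M y → ∃ t, c < |y t| / σ t := by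
    intro y c hc hcy
    by_contra! hcon
    exact absurd ((ContinuousMap.norm_le _ hc).2 fun t => (hyt y t).trans_le (hcon t))
      (not_le.2 hcy)
  have hM0 : ∀ y, 0 ≤ M y := fun y => norm_nonneg _
  have hev : ∀ t : unitInterval, Measurable fun x : FSp => x t := fun t =>
    (by fun_prop : Continuous fun x : FSp => x t).measurable
  -- depth
  have hdepth : ∀ (y : FSp) t, pdepth P (T y) t = auxψ (|y t| / σ t) := by
    intro y t
    have e1 : P {x : FSp | T y t < x t} =
        (ProbabilityTheory.gaussianReal 0 1) (Ioi (y t / σ t)) := by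
      rw [hP, hemb.map_apply]
      have : T ⁻¹' {x : FSp | T y t < x t} = (fun x : FSp => x t) ⁻¹' (Ioi (y t)) := by
        ext z
        simp only [mem_preimage, mem_ofPred_eq, mem_Ioi, hT]
        exact (hmono t).lt_iff_lt
      rw [this, ← Measure.map_apply (hev t) measurableSet_Ioi, hmargin,
        auxGauss_scale _ (hσ t) _ measurableSet_Ioi]
      congr 1; ext z
      simp only [mem_Ioi, mem_ofPred_eq, div_lt_iff₀ (hσ t), mul_comm]
    have e2 : P {x : FSp | x t < T y t} =
        (ProbabilityTheory.gaussianReal 0 1) (Iio (y t / σ t)) := by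
      rw [hP, hemb.map_apply]
      have : T ⁻¹' {x : FSp | x t < T y t} = (fun x : FSp => x t) ⁻¹' (Iio (y t)) := by
        ext z
        simp only [mem_preimage, mem_ofPred_eq, mem_Iio, hT]
        exact (hmono t).lt_iff_lt
      rw [this, ← Measure.map_apply (hev t) measurableSet_Iio, hmargin,
        auxGauss_scale _ (hσ t) _ measurableSet_Iio]
      congr 1; ext z
      simp only [mem_Iio, mem_ofPred_eq, lt_div_iff₀ (hσ t), mul_comm]
    unfold pdepth
    rw [e1, e2]
    have := auxG_abs (y t / σ t)
    unfold auxG at this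
    rw [this, abs_div, abs_of_pos (hσ t)]
    unfold auxψ auxG
    ring
  have hcmp : ∀ y z : FSp, M z < M y → prec P (T y) (T z) ∧ ¬ prec P (T z) (T y) := by
    intro y z hzy
    obtain ⟨b, hb1, hb2⟩ := exists_between hzy
    obtain ⟨a, ha1, ha2⟩ := exists_between hb1
    have hz0 := hM0 z
    refine aux_prec P _ _ (auxψ b) (auxψ a) (auxψ_nonneg b) (auxψ_anti ha2)
      (auxψ_le (by linarith)) ?_ ?_
    · obtain ⟨t, ht⟩ := hMlt y b (by linarith) hb2
      unfold dcdf
      apply ENNReal.toReal_pos _ (measure_ne_top _ _)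
      have hopen : IsOpen {t : unitInterval | b < ‖(y * τ) t‖} :=
        isOpen_lt continuous_const (by fun_prop)
      have hpos := aux_vol_pos _ hopen ⟨t, by
        rw [mem_ofPred_eq, hyt]; exact ht⟩
      refine (hpos.trans_le (measure_mono ?_)).ne'
      intro t ht
      rw [mem_ofPred_eq, hyt] at ht
      rw [mem_ofPred_eq, hdepth]
      exact (auxψ_anti ht).le
    · unfold dcdf
      have : {t : unitInterval | pdepth P (T z) t ≤ auxψ a} = ∅ := by
        ext t
        simp only [mem_ofPred_eq, mem_empty_iff_false, iff_false, not_le, hdepth]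
        exact auxψ_anti ((hMle z t).trans_lt ha1)
      rw [this]; simp
  have hed : ∀ y : FSp, ed P (T y) = (P_Y {z | M y < M z}).toReal := by
    intro y
    unfold ed
    congr 1
    rw [hP, hemb.map_apply, ← hP]
    apply le_antisymm
    · calc P_Y (T ⁻¹' {x : FSp | ¬ prec P (T y) x})
          ≤ P_Y ({z | M y < M z} ∪ {z | (⨆ t, |z t| / σ t) = M y}) := by
            apply measure_mono
            intro z hz
            rcases lt_trichotomy (M y) (M z) with h1 | h1 | h1
            · exact Or.inl h1
            · exact Or.inr (by rw [mem_ofPred_eq, ← hMsup, h1])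
            · exact absurd (hcmp y z h1).1 hz
        _ ≤ P_Y {z | M y < M z} + P_Y {z | (⨆ t, |z t| / σ t) = M y} := measure_union_le _ _
        _ = _ := by rw [hatom, add_zero]
    · apply measure_mono
      intro z hz
      exact (hcmp z y hz).2
  have hmeasM : Measurable M := hMc.measurable
  let ν := P_Y.map M
  have : IsProbabilityMeasure ν := Measure.isProbabilityMeasure_map hmeasM.aemeasurable
  have : NullSingletonClass ν := ⟨fun c => by
    change P_Y.map M {c} = 0
    rw [Measure.map_apply hmeasM (measurableSet_singleton c), ← hatom c]
    congr 1; ext z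
    simp only [mem_preimage, mem_singleton_iff, mem_ofPred_eq, hMsup]⟩
  have htail : ∀ c : ℝ, (P_Y {z | c < M z}).toReal = 1 - ProbabilityTheory.cdf ν c := by
    intro c
    have h1 : P_Y {z | c < M z} = ν (Iic c)ᶜ := by
      rw [Measure.map_apply hmeasM measurableSet_Iic.compl]
      congr 1; ext z; simp
    rw [h1, ProbabilityTheory.cdf_eq_real]
    exact probReal_compl_eq_one_sub measurableSet_Iic
  have hcdf0 : ProbabilityTheory.cdf ν 0 = 0 := by
    rw [ProbabilityTheory.cdf_eq_real]
    have h1 : ν (Iic 0) = 0 := by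
      rw [Measure.map_apply hmeasM measurableSet_Iic, ← hatom 0]
      congr 1; ext z
      simp only [mem_preimage, mem_Iic, mem_ofPred_eq, ← hMsup]
      exact ⟨fun h => le_antisymm h (hM0 z), fun h => h.le⟩
    simp [Measure.real, h1]
  ext α
  simp only [mem_ofPred_eq, mem_Ioc, mem_Icc]
  constructor
  · rintro ⟨⟨-, h1⟩, f, rfl⟩
    refine ⟨?_, h1⟩
    obtain ⟨y, rfl⟩ := hTsurj f
    rw [hed]
    apply ENNReal.toReal_pos _ (measure_ne_top _ _)
    have hsub : (fun x : FSp => x 0) ⁻¹' (Ioi (M y * σ 0)) ⊆ {z | M y < M z} := by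
      intro z hz
      simp only [mem_preimage, mem_Ioi] at hz
      have h2 : M y < z 0 / σ 0 := (lt_div_iff₀ (hσ 0)).2 hz
      have h3 : z 0 / σ 0 ≤ |z 0| / σ 0 := by
        have := (hσ 0).le
        gcongr
        exact le_abs_self _
      exact h2.trans_le (h3.trans (hMle z 0))
    refine (lt_of_lt_of_le ?_ (measure_mono hsub)).ne'
    rw [← Measure.map_apply (hev 0) measurableSet_Ioi, hmargin,
        auxGauss_scale _ (hσ 0) _ measurableSet_Ioi]
    apply auxGauss_pos
    · exact isOpen_Ioi.preimage (continuous_const.mul continuous_id)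
    · refine ⟨M y + 1, ?_⟩
      have := hσ 0
      simp only [mem_ofPred_eq, mem_Ioi]
      nlinarith
  · rintro ⟨h0, h1⟩
    refine ⟨⟨h0.le, h1⟩, ?_⟩
    have hev1 : ∀ᶠ b in atTop, 1 - α < ProbabilityTheory.cdf ν b :=
      (ProbabilityTheory.tendsto_cdf_atTop ν).eventually (lt_mem_nhds (by linarith))
    obtain ⟨b, hb1, hb0⟩ := (hev1.and (eventually_ge_atTop 0)).exists
    obtain ⟨c, hc, hcα⟩ := intermediate_value_Icc hb0 (aux_cdf_cont ν).continuousOn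
      (show 1 - α ∈ Icc _ _ from ⟨by rw [hcdf0]; linarith, hb1.le⟩)
    refine ⟨T (c • σ), ?_⟩
    have hMc : M (c • σ) = c := by
      rw [hMsup]
      have : ∀ t, |(c • σ) t| / σ t = c := by
        intro t
        have := hσ t
        rw [ContinuousMap.smul_apply, smul_eq_mul, abs_mul, abs_of_pos this, abs_of_nonneg hc.1]
        field_simp
      simp only [this, ciSup_const]
    rw [hed, hMc, htail, hcα]
    ring
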